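/- Let ι be a nonempty finite type, (Ω, ℙ) a probability space, λ ∈ [0,1], and 0 < β_l ≤ β_u real numbers. For each z ∈ ι let m z ≥ 1 be a natural number, let N = ∑_z m z, and let (X z j)_{j < m z} be independent square-integrable real random variables each with mean μ z and variance (σ z)². Let P_D : ι → ℝ be a nonnegative probability mass function, and let p' : ι → ℝ with p' z > 0 and β_l ≤ (m z / N) / p' z ≤ β_u for every z, and B' : ι → ℝ. Let ς, ξ ≥ 0 satisfy (σ z)² / m z ≤ ς and (μ z − B' z)² ≤ ξ for every z. Define, for each z, D z = (1−λ)·(m z / N) + λ·p' z and the random variable Y z = ( (1−λ)/N · ∑_{j < m z} X z j + λ·p' z·B' z ) / D z. Then E[ ∑_z P_D z · (Y z − μ z)² ] ≤ ( (1−λ) / (1−λ + λ/β_u) )² · ς + ( λ / ((1−λ)·β_l + λ) )² · ξ. -/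

import Mathlib

open MeasureTheory ProbabilityTheory Finset

lemma coef_aux (lam βl βu q p : ℝ) (h0 : 0 ≤ lam) (h1 : lam ≤ 1) (hβl : 0 < βl) (hβu : 0 < βu)
    (hq : 0 < q) (hp : 0 < p) (hl : βl ≤ q / p) (hu : q / p ≤ βu) :
    0 < (1 - lam) * q + lam * p ∧
    ((1 - lam) * q / ((1 - lam) * q + lam * p)) ^ 2 ≤ ((1 - lam) / (1 - lam + lam / βu)) ^ 2 ∧
    (lam * p / ((1 - lam) * q + lam * p)) ^ 2 ≤ (lam / ((1 - lam) * βl + lam)) ^ 2 := by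
  rw [le_div_iff₀ hp] at hl
  rw [div_le_iff₀ hp] at hu
  have h2 : 0 ≤ 1 - lam := by linarith
  have key : ∀ x y : ℝ, 0 < x → 0 < y → 0 < (1 - lam) * x + lam * y := by
    intro x y hx hy
    rcases h0.eq_or_lt with h | h
    · subst h; linarith
    · have := mul_pos h hy
      have := mul_nonneg h2 hx.le
      linarith
  have hD := key q p hq hp
  have hA : 0 < 1 - lam + lam / βu := by
    have := key 1 (1 / βu) one_pos (by positivity)
    calc 0 < _ := this
      _ = _ := by ring
  have hB : 0 < (1 - lam) * βl + lam := by
    have := key βl 1 hβl one_pos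
    linarith
  refine ⟨hD, ?_, ?_⟩
  · apply pow_le_pow_left₀ (by positivity)
    rw [div_le_div_iff₀ hD hA]
    have h3 : q / βu ≤ p := by rw [div_le_iff₀ hβu]; linarith
    have h4 : lam / βu * q ≤ lam * p := by
      calc lam / βu * q = lam * (q / βu) := by ring
        _ ≤ _ := by gcongr
    have := mul_le_mul_of_nonneg_left h4 h2
    linarith
  · apply pow_le_pow_left₀ (by positivity)
    rw [div_le_div_iff₀ hD hB]
    have := mul_le_mul_of_nonneg_left hl (mul_nonneg h0 h2)
    linarith

lemma second_moment_aux {Ω : Type*} [MeasurableSpace Ω] (P : Measure Ω) [IsProbabilityMeasure P]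
    (n : ℕ) (X : Fin n → Ω → ℝ) (hindep : iIndepFun X P) (hL2 : ∀ j, MemLp (X j) 2 P)
    (μ v a c : ℝ) (hmean : ∀ j, ∫ ω, X j ω ∂P = μ) (hvar : ∀ j, variance (X j) P = v) :
    Integrable (fun ω => (a * (∑ j, X j ω - n * μ) + c) ^ 2) P ∧
    ∫ ω, (a * (∑ j, X j ω - n * μ) + c) ^ 2 ∂P = a ^ 2 * (n * v) + c ^ 2 := by
  have hS : MemLp (fun ω => ∑ j, X j ω) 2 P := memLp_finsetSum _ (fun j _ => hL2 j)
  have hW : MemLp (fun ω => ∑ j, X j ω - n * μ) 2 P := hS.sub (memLp_const _)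
  have hES : ∫ ω, ∑ j, X j ω ∂P = n * μ := by
    rw [integral_finsetSum _ (fun j _ => (hL2 j).integrable one_le_two)]
    simp [hmean]
  have hEW : ∫ ω, (∑ j, X j ω - n * μ) ∂P = 0 := by
    rw [integral_sub (hS.integrable one_le_two) (integrable_const _), hES]
    simp
  have hV : ∫ ω, (∑ j, X j ω - n * μ) ^ 2 ∂P = n * v := by
    have h1 := variance_eq_integral (μ := P) hS.aemeasurable
    rw [hES] at h1
    rw [← h1]
    have h2 := IndepFun.variance_sum (μ := P) (X := X) (s := Finset.univ) (fun j _ => hL2 j)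
      (fun i _ j _ hij => hindep.indepFun hij)
    have h3 : (fun ω => ∑ j, X j ω) = ∑ j, X j := by ext; simp
    rw [h3, h2]
    simp [hvar]
  have hf : (fun ω => (a * (∑ j, X j ω - n * μ) + c) ^ 2) = fun ω =>
      a ^ 2 * (∑ j, X j ω - n * μ) ^ 2 + 2 * a * c * (∑ j, X j ω - n * μ) + c ^ 2 := by
    ext; ring
  have i1 : Integrable (fun ω => a ^ 2 * (∑ j, X j ω - n * μ) ^ 2) P := hW.integrable_sq.const_mul _
  have i2 : Integrable (fun ω => 2 * a * c * (∑ j, X j ω - n * μ)) P :=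
    (hW.integrable one_le_two).const_mul _
  have i3 : Integrable (fun ω => a ^ 2 * (∑ j, X j ω - n * μ) ^ 2
      + 2 * a * c * (∑ j, X j ω - n * μ)) P := i1.add i2
  rw [hf]
  refine ⟨i3.add (integrable_const _), ?_⟩
  rw [integral_add i3 (integrable_const _), integral_add i1 i2,
    integral_const_mul, integral_const_mul, hEW, hV]
  simp

/-- Theorem 1 (Expected Performance Bound) in finitary form. -/
theorem stmt_7 {ι : Type*} [Fintype ι] [Nonempty ι]
    {Ω : Type*} [MeasurableSpace Ω] (P : Measure Ω) [IsProbabilityMeasure P]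
    (lam : ℝ) (hlam : lam ∈ Set.Icc (0 : ℝ) 1)
    (βl βu : ℝ) (hβl : 0 < βl) (hβlu : βl ≤ βu)
    (m : ι → ℕ) (hm : ∀ z, 1 ≤ m z)
    (N : ℕ) (hN : N = ∑ z, m z)
    (X : ∀ z, Fin (m z) → Ω → ℝ)
    (hindep : ∀ z, iIndepFun (X z) P)
    (hL2 : ∀ z j, MemLp (X z j) 2 P)
    (μ : ι → ℝ) (hmean : ∀ z j, ∫ ω, X z j ω ∂P = μ z)
    (σ : ι → ℝ) (hvar : ∀ z j, variance (X z j) P = (σ z) ^ 2)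
    (PD : ι → ℝ) (hPD : ∀ z, 0 ≤ PD z) (hPDsum : ∑ z, PD z = 1)
    (p' : ι → ℝ) (hp' : ∀ z, 0 < p' z)
    (hratio : ∀ z, βl ≤ ((m z : ℝ) / N) / p' z ∧ ((m z : ℝ) / N) / p' z ≤ βu)
    (B' : ι → ℝ)
    (ς ξ : ℝ) (hς : 0 ≤ ς) (hξ : 0 ≤ ξ)
    (hvarbound : ∀ z, (σ z) ^ 2 / (m z : ℝ) ≤ ς)
    (hgap : ∀ z, (μ z - B' z) ^ 2 ≤ ξ)
    (Dd : ι → ℝ) (hDd : ∀ z, Dd z = (1 - lam) * ((m z : ℝ) / N) + lam * p' z)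
    (Y : ι → Ω → ℝ)
    (hY : ∀ z ω, Y z ω = ((1 - lam) / N * ∑ j, X z j ω + lam * p' z * B' z) / Dd z) :
    ∫ ω, ∑ z, PD z * (Y z ω - μ z) ^ 2 ∂P ≤
      ((1 - lam) / (1 - lam + lam / βu)) ^ 2 * ς +
        (lam / ((1 - lam) * βl + lam)) ^ 2 * ξ := by
  obtain ⟨h0, h1⟩ := hlam
  have hβu : 0 < βu := hβl.trans_le hβlu
  have hmpos : ∀ z, (0 : ℝ) < m z := fun z => by exact_mod_cast hm z
  have hNpos : (0 : ℝ) < N := by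
    rw [hN]; push_cast
    exact Finset.sum_pos (fun z _ => hmpos z) Finset.univ_nonempty
  have main : ∀ z, Integrable (fun ω => (Y z ω - μ z) ^ 2) P ∧
      ∫ ω, (Y z ω - μ z) ^ 2 ∂P ≤ ((1 - lam) / (1 - lam + lam / βu)) ^ 2 * ς +
        (lam / ((1 - lam) * βl + lam)) ^ 2 * ξ := by
    intro z
    obtain ⟨hD, hA, hB⟩ := coef_aux lam βl βu (m z / N) (p' z) h0 h1 hβl hβu
      (div_pos (hmpos z) hNpos) (hp' z) (hratio z).1 (hratio z).2
    rw [← hDd z] at hD hA hB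
    have hm0 := (hmpos z).ne'
    have hf : (fun ω => (Y z ω - μ z) ^ 2) = fun ω =>
        ((1 - lam) / N / Dd z * (∑ j, X z j ω - m z * μ z)
          + lam * p' z / Dd z * (B' z - μ z)) ^ 2 := by
      ext ω
      congr 1
      rw [hY, div_sub' hD.ne']
      have : Dd z * μ z = (1 - lam) / N * (m z * μ z) + lam * p' z * μ z := by
        rw [hDd]; ring
      rw [this]; ring
    obtain ⟨hi, he⟩ := second_moment_aux P (m z) (X z) (hindep z) (hL2 z) (μ z) (σ z ^ 2)
      ((1 - lam) / N / Dd z) (lam * p' z / Dd z * (B' z - μ z)) (hmean z) (hvar z)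
    rw [hf]
    refine ⟨hi, ?_⟩
    rw [he]
    have e1 : ((1 - lam) / N / Dd z) ^ 2 * (m z * σ z ^ 2)
        = ((1 - lam) * (m z / N) / Dd z) ^ 2 * (σ z ^ 2 / m z) := by
      field_simp
    have e2 : (lam * p' z / Dd z * (B' z - μ z)) ^ 2
        = (lam * p' z / Dd z) ^ 2 * (μ z - B' z) ^ 2 := by ring
    rw [e1, e2]
    have hv := hvarbound z
    have hg := hgap z
    gcongr ?_ + ?_
    · exact mul_le_mul hA hv (by positivity) (by positivity)
    · exact mul_le_mul hB hg (by positivity) (by positivity)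
  rw [integral_finsetSum _ (fun z _ => (main z).1.const_mul _)]
  simp_rw [integral_const_mul]
  refine (Finset.sum_le_sum (fun z _ => mul_le_mul_of_nonneg_left (main z).2 (hPD z))).trans ?_
  rw [← Finset.sum_mul, hPDsum, one_mul]
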